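/- arXiv:1401.4907 — 3 statements merged into one kernel-verified Lean document; each statement's English description precedes it below -/
import Mathlib

section
/- Let Θ = (α, ρ_r, ρ_d, ρ_s, ρ_0, T) be a parameter tuple with T > 1 and let R > 0 satisfy ρ_r + 2ρ_0 ≥ α/(1 + ⌊√T⌋) + (α(1 + ⌊√T⌋)/⌊√T⌋)·(2^(R/(1 − ⌊√T⌋/T)) − 1). Then for every (M,K,τ) ∈ ℤ³ with 1 ≤ K ≤ τ < T, M > K and (M,K) ≠ (2,1), one has P(M,K,τ,R,Θ) > inf{ P(2,1,τ',R,Θ) : τ' ∈ ℤ, 1 ≤ τ' < T }; that is, the minimum of P over all admissible integer triples is attained only with M = 2 and K = 1. -/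
open Real

/-- Uplink SINR-like quantity γ_u(M,K,τ,R,T). -/
noncomputable def gammaU (M K τ R T : ℝ) : ℝ :=
  ((K + τ) * ((2:ℝ) ^ (R / (K * (1 - τ / T))) - 1)) / (2 * τ * (M - K)) +
    Real.sqrt ((((K + τ) * ((2:ℝ) ^ (R / (K * (1 - τ / T))) - 1)) / (2 * τ * (M - K))) ^ 2 +
      ((2:ℝ) ^ (R / (K * (1 - τ / T))) - 1) / (τ * (M - K)))

/-- Total normalized power consumption P(M,K,τ,R,Θ). -/
noncomputable def Ptot (M K τ R α ρr ρd ρs ρ0 T : ℝ) : ℝ :=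
  α * K * gammaU M K τ R T + ρs + K * (ρd + (8/3) * K ^ 2 * ρ0 / T) +
    M * (ρr + 2 * K * ρ0 + 4 * K ^ 2 * ρ0 / T)

/-- Optimal normalized energy efficiency ζ*_zf(R,Θ) (integer optimization). -/
noncomputable def zetaZfStar (R α ρr ρd ρs ρ0 T : ℝ) : ℝ :=
  R / sInf {p : ℝ | ∃ M K τ : ℤ, 1 ≤ K ∧ K ≤ τ ∧ (τ : ℝ) < T ∧ K < M ∧
    p = Ptot (M : ℝ) (K : ℝ) (τ : ℝ) R α ρr ρd ρs ρ0 T}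

/-- Maximum number of users K_max(Θ). -/
noncomputable def Kmax (ρr ρd ρ0 T : ℝ) : ℝ :=
  min (T / 4) (min (ρr / (3 * ρ0)) (3 * ρd / (2 * ρ0)))

/-- The function g(x). -/
noncomputable def gfun (x : ℝ) : ℝ :=
  Real.sqrt (x / ((2:ℝ) ^ x - 1)) * ((2:ℝ) ^ x * x * Real.log 2 - (2:ℝ) ^ x + 1)

/-- Ideal (perfect CSI) power consumption P_csi(M,K,R,Θ). -/
noncomputable def Pcsi (M K R α ρr ρd ρs : ℝ) : ℝ :=
  α * K * ((2:ℝ) ^ (R / K) - 1) / (M - K) + M * ρr + K * ρd + ρs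

/-- Relaxed (real-valued) optimal EE ζ'_zf(R,Θ) with K ≤ K_max(Θ). -/
noncomputable def zetaZfPrime (R α ρr ρd ρs ρ0 T : ℝ) : ℝ :=
  R / sInf {p : ℝ | ∃ M K τ : ℝ, 1 ≤ K ∧ K ≤ Kmax ρr ρd ρ0 T ∧ K ≤ τ ∧ τ < T ∧ K < M ∧
    p = Ptot M K τ R α ρr ρd ρs ρ0 T}

/-- Optimal EE of the ideal perfect-CSI system ζ'_csi(R,Θ). -/
noncomputable def zetaCsiPrime (R α ρr ρd ρs ρ0 T : ℝ) : ℝ :=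
  R / sInf {p : ℝ | ∃ M K : ℝ, 1 ≤ K ∧ K ≤ Kmax ρr ρd ρ0 T ∧ K < M ∧
    p = Pcsi M K R α ρr ρd ρs}

/-- Relaxed optimal EE with the number of users fixed to K. -/
noncomputable def zetaZfFixedK (K R α ρr ρd ρs ρ0 T : ℝ) : ℝ :=
  R / sInf {p : ℝ | ∃ M τ : ℝ, K < M ∧ K ≤ τ ∧ τ < T ∧
    p = Ptot M K τ R α ρr ρd ρs ρ0 T}

lemma two_rpow_div_sub_one_pos {K τ R T : ℝ} (hK : 0 < K) (hT : 0 < T) (hτT : τ < T) (hR : 0 < R) :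
    0 < (2:ℝ) ^ (R / (K * (1 - τ / T))) - 1 := by
  have h : τ / T < 1 := (div_lt_one hT).2 hτT
  have hexp : 0 < R / (K * (1 - τ / T)) := div_pos hR (mul_pos hK (by linarith))
  linarith [Real.one_lt_rpow (by norm_num : (1:ℝ) < 2) hexp]

lemma gammaU_nonneg {M K τ R T : ℝ} (hK : 0 < K) (hτ : 0 < τ) (hT : 0 < T) (hτT : τ < T)
    (hKM : K < M) (hR : 0 < R) : 0 ≤ gammaU M K τ R T := by
  have hE := two_rpow_div_sub_one_pos hK hT hτT hR
  have hMK : 0 < M - K := sub_pos.2 hKM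
  unfold gammaU
  positivity

lemma gammaU_two_one_lt {τ R T : ℝ} (hτ : 0 < τ) (hT : 0 < T) (hτT : τ < T) (hR : 0 < R) :
    gammaU 2 1 τ R T < 1 / (1 + τ) + (1 + τ) / τ * ((2:ℝ) ^ (R / (1 - τ / T)) - 1) := by
  have hE := two_rpow_div_sub_one_pos one_pos hT hτT hR
  rw [one_mul] at hE
  unfold gammaU
  rw [one_mul]
  set E := (2:ℝ) ^ (R / (1 - τ / T)) - 1
  have hsqrt : √(((1 + τ) * E / (2 * τ * (2 - 1))) ^ 2 + E / (τ * (2 - 1))) <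
      (1 + τ) * E / (2 * τ * (2 - 1)) + 1 / (1 + τ) := by
    rw [Real.sqrt_lt' (by norm_num; positivity)]
    have hsq : ((1 + τ) * E / (2 * τ * (2 - 1)) + 1 / (1 + τ)) ^ 2 =
        ((1 + τ) * E / (2 * τ * (2 - 1))) ^ 2 + E / (τ * (2 - 1)) + (1 / (1 + τ)) ^ 2 := by
      norm_num
      field_simp
      ring
    rw [hsq]
    have : 0 < (1 / (1 + τ)) ^ 2 := by positivity
    linarith
  have hsum : (1 + τ) * E / (2 * τ * (2 - 1)) + (1 + τ) * E / (2 * τ * (2 - 1)) =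
      (1 + τ) / τ * E := by
    norm_num
    field_simp
    ring
  linarith

lemma Ptot_ge_of_three_le {M K τ R α ρr ρd ρs ρ0 T : ℝ} (hR : 0 < R) (hα : 0 < α) (hT : 0 < T)
    (hρr : 0 < ρr) (hρd : 0 < ρd) (hρ0 : 0 < ρ0) (hK : 1 ≤ K) (hKτ : K ≤ τ) (hτT : τ < T)
    (hKM : K < M) (hM : 3 ≤ M) :
    ρs + (ρd + (8/3) * ρ0 / T) + 3 * (ρr + 2 * ρ0 + 4 * ρ0 / T) ≤
      Ptot M K τ R α ρr ρd ρs ρ0 T := by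
  have hK0 : 0 < K := by linarith
  have hγ := gammaU_nonneg hK0 (by linarith) hT hτT hKM hR
  have hαγ : 0 ≤ α * K * gammaU M K τ R T := by positivity
  have hK2 : 1 ≤ K ^ 2 := one_le_pow₀ hK
  have hd : 1 * (ρd + (8/3) * 1 * ρ0 / T) ≤ K * (ρd + (8/3) * K ^ 2 * ρ0 / T) := by gcongr
  have hr : 3 * (ρr + 2 * 1 * ρ0 + 4 * 1 * ρ0 / T) ≤
      M * (ρr + 2 * K * ρ0 + 4 * K ^ 2 * ρ0 / T) := by gcongr
  simp only [mul_one, one_mul] at hd hr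
  unfold Ptot
  linarith

lemma Ptot_nonneg {M K τ R α ρr ρd ρs ρ0 T : ℝ} (hR : 0 < R) (hα : 0 < α) (hT : 0 < T)
    (hρr : 0 < ρr) (hρd : 0 < ρd) (hρs : 0 < ρs) (hρ0 : 0 < ρ0) (hK : 0 < K) (hτ : 0 < τ)
    (hτT : τ < T) (hKM : K < M) : 0 ≤ Ptot M K τ R α ρr ρd ρs ρ0 T := by
  have hγ := gammaU_nonneg hK hτ hT hτT hKM hR
  have hM : 0 < M := hK.trans hKM
  unfold Ptot
  positivity

/-- for large PCPs the optimum is attained only at (M,K) = (2,1) (Theorem 2). -/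
theorem stmt_2 (R α ρr ρd ρs ρ0 T : ℝ)
    (hR : 0 < R) (hα : 1 < α) (hT : 1 < T)
    (hρr : 0 < ρr) (hρd : 0 < ρd) (hρs : 0 < ρs) (hρ0 : 0 < ρ0)
    (hcond : ρr + 2 * ρ0 ≥ α / (1 + (⌊Real.sqrt T⌋ : ℝ)) +
      α * (1 + (⌊Real.sqrt T⌋ : ℝ)) / (⌊Real.sqrt T⌋ : ℝ) *
        ((2:ℝ) ^ (R / (1 - (⌊Real.sqrt T⌋ : ℝ) / T)) - 1)) :
    ∀ M K τ : ℤ, 1 ≤ K → K ≤ τ → (τ : ℝ) < T → K < M → ¬(M = 2 ∧ K = 1) →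
      sInf {p : ℝ | ∃ τ' : ℤ, 1 ≤ τ' ∧ (τ' : ℝ) < T ∧
          p = Ptot 2 1 (τ' : ℝ) R α ρr ρd ρs ρ0 T} <
        Ptot (M : ℝ) (K : ℝ) (τ : ℝ) R α ρr ρd ρs ρ0 T := by
  intro M K τ hK hKτ hτT hKM hne
  have hT0 : 0 < T := by linarith
  have hα0 : 0 < α := by linarith
  have hM3 : 3 ≤ M := by lia
  set t : ℤ := ⌊Real.sqrt T⌋ with ht
  have ht1 : 1 ≤ t := Int.le_floor.2 (by simpa using hT.le)
  have ht0 : (0:ℝ) < t := by exact_mod_cast ht1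
  have htT : (t:ℝ) < T := (Int.floor_le _).trans_lt <| (Real.sqrt_lt' hT0).2 (by nlinarith)
  have hbdd : BddBelow {p : ℝ | ∃ τ' : ℤ, 1 ≤ τ' ∧ (τ' : ℝ) < T ∧
      p = Ptot 2 1 (τ' : ℝ) R α ρr ρd ρs ρ0 T} := by
    refine ⟨0, ?_⟩
    rintro p ⟨τ', h1, h2, rfl⟩
    exact Ptot_nonneg hR hα0 hT0 hρr hρd hρs hρ0 one_pos (by exact_mod_cast h1) h2 one_lt_two
  refine (csInf_le hbdd ⟨t, ht1, htT, rfl⟩).trans_lt ?_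
  have hlow : ρs + (ρd + (8/3) * ρ0 / T) + 3 * (ρr + 2 * ρ0 + 4 * ρ0 / T) ≤
      Ptot (M : ℝ) (K : ℝ) (τ : ℝ) R α ρr ρd ρs ρ0 T :=
    Ptot_ge_of_three_le hR hα0 hT0 hρr hρd hρ0 (by exact_mod_cast hK) (by exact_mod_cast hKτ)
      hτT (by exact_mod_cast hKM) (by exact_mod_cast hM3)
  refine lt_of_lt_of_le ?_ hlow
  have hγ := mul_lt_mul_of_pos_left (gammaU_two_one_lt ht0 hT0 htT hR) hα0
  have hrhs : α * (1 / (1 + (t:ℝ)) + (1 + (t:ℝ)) / t * ((2:ℝ) ^ (R / (1 - (t:ℝ) / T)) - 1)) =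
      α / (1 + (t:ℝ)) + α * (1 + (t:ℝ)) / t * ((2:ℝ) ^ (R / (1 - (t:ℝ) / T)) - 1) := by
    ring
  have hpos : 0 < 4 * ρ0 / T := by positivity
  unfold Ptot
  simp only [mul_one, one_mul, one_pow]
  linarith
end

section
/- Let g(x) := sqrt(x/(2^x − 1))·(2^x·x·ln 2 − 2^x + 1) for x > 0. Then for every R > 0 and every parameter tuple Θ = (α, ρ_r, ρ_d, ρ_s, ρ_0, T), there exists a unique x' > 0 such that g(x') = (1 + ρ_d/ρ_r)·sqrt(R·ρ_r/α). -/
open Real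

theorem one_lt_two_rpow {x : ℝ} (hx : 0 < x) : 1 < (2:ℝ) ^ x :=
  Real.one_lt_rpow (by norm_num) hx

/-- `gfun` as a product of two positive strictly increasing factors. -/
theorem gfun_eq_sqrt_mul {x : ℝ} (hx : 0 < x) :
    gfun x = √(x * ((2:ℝ) ^ x - 1)) * (x * Real.log 2 / (1 - ((2:ℝ) ^ x)⁻¹) - 1) := by
  have h1 := one_lt_two_rpow hx
  have hE : 0 < (2:ℝ) ^ x - 1 := by linarith
  have hs : x * ((2:ℝ) ^ x - 1) = x / ((2:ℝ) ^ x - 1) * ((2:ℝ) ^ x - 1) ^ 2 := by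
    field_simp
  have hq : x * Real.log 2 / (1 - ((2:ℝ) ^ x)⁻¹) = x * Real.log 2 * (2:ℝ) ^ x / ((2:ℝ) ^ x - 1) := by
    have h0 : 0 < (2:ℝ) ^ x := by linarith
    have h2 : 1 - ((2:ℝ) ^ x)⁻¹ = ((2:ℝ) ^ x - 1) / (2:ℝ) ^ x := by field_simp
    rw [h2, div_div_eq_mul_div]
  rw [gfun, hs, Real.sqrt_mul (by positivity), Real.sqrt_sq hE.le, hq]
  field_simp
  ring

theorem div_one_sub_exp_neg_strictMono {a b : ℝ} (ha : 0 < a) (hab : a < b) :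
    a / (1 - rexp (-a)) < b / (1 - rexp (-b)) := by
  have hb : 0 < b := ha.trans hab
  have h := strictConvexOn_exp.secant_strict_mono (a := 0) (x := -b) (y := -a)
    trivial trivial trivial (by linarith) (by linarith) (by linarith)
  have hA : rexp (-a) < 1 := Real.exp_lt_one_iff.2 (by linarith)
  have hB : rexp (-b) < 1 := Real.exp_lt_one_iff.2 (by linarith)
  have e (t : ℝ) : (rexp (-t) - rexp 0) / (-t - 0) = (1 - rexp (-t)) / t := by
    rw [Real.exp_zero, ← neg_div_neg_eq]
    congr 1 <;> ring
  rw [e, e, div_lt_div_iff₀ hb ha] at h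
  rw [div_lt_div_iff₀ (by linarith) (by linarith)]
  linarith

theorem inv_two_rpow_eq_exp (x : ℝ) : ((2:ℝ) ^ x)⁻¹ = rexp (-(x * Real.log 2)) := by
  rw [Real.rpow_def_of_pos (by norm_num), ← Real.exp_neg, mul_comm]

theorem one_lt_div_one_sub_exp_neg {u : ℝ} (hu : 0 < u) : 1 < u / (1 - rexp (-u)) := by
  have h1 : rexp (-u) < 1 := Real.exp_lt_one_iff.2 (by linarith)
  have h2 := Real.add_one_lt_exp (x := -u) (by linarith)
  rw [lt_div_iff₀ (by linarith)]
  linarith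

theorem div_one_sub_exp_neg_le {u : ℝ} (hu : 0 < u) : u / (1 - rexp (-u)) ≤ 1 + u := by
  have h1 : rexp (-u) < 1 := Real.exp_lt_one_iff.2 (by linarith)
  have h2 := Real.add_one_le_exp u
  have h3 : rexp (-u) * rexp u = 1 := by rw [← Real.exp_add]; simp
  rw [div_le_iff₀ (by linarith)]
  nlinarith [Real.exp_pos (-u)]

theorem gfun_strictMonoOn : StrictMonoOn gfun (Set.Ioi 0) := by
  intro a (ha : 0 < a) b (hb : 0 < b) hab
  have hL : 0 < Real.log 2 := Real.log_pos (by norm_num)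
  rw [gfun_eq_sqrt_mul ha, gfun_eq_sqrt_mul hb, inv_two_rpow_eq_exp, inv_two_rpow_eq_exp]
  have h1 := one_lt_two_rpow ha
  have h2 : (2:ℝ) ^ a < (2:ℝ) ^ b := Real.rpow_lt_rpow_of_exponent_lt (by norm_num) hab
  refine mul_lt_mul'' (Real.sqrt_lt_sqrt (mul_nonneg ha.le (by linarith)) ?_) ?_
    (Real.sqrt_nonneg _) ?_
  · exact mul_lt_mul'' hab (by linarith) ha.le (by linarith)
  · linarith [div_one_sub_exp_neg_strictMono (mul_pos ha hL) (mul_lt_mul_of_pos_right hab hL)]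
  · linarith [one_lt_div_one_sub_exp_neg (mul_pos ha hL)]

theorem gfun_continuousOn : ContinuousOn gfun (Set.Ioi 0) := by
  have hp : Continuous fun x : ℝ => (2:ℝ) ^ x := Real.continuous_const_rpow (by norm_num)
  unfold gfun
  refine ContinuousOn.mul (ContinuousOn.sqrt (continuousOn_id.div (by fun_prop) ?_)) (by fun_prop)
  intro x hx
  linarith [one_lt_two_rpow hx]

theorem exists_gfun_lt {c : ℝ} (hc : 0 < c) : ∃ x, 0 < x ∧ gfun x < c := by
  have hp : Continuous fun x : ℝ => (2:ℝ) ^ x := Real.continuous_const_rpow (by norm_num)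
  have hcont : Continuous fun x : ℝ => √(x * ((2:ℝ) ^ x - 1)) * (x * Real.log 2) := by fun_prop
  have hev : ∀ᶠ x in nhds (0:ℝ), √(x * ((2:ℝ) ^ x - 1)) * (x * Real.log 2) < c :=
    hcont.continuousAt.eventually_lt continuousAt_const (by simpa using hc)
  obtain ⟨x, hxc, hx⟩ := ((hev.filter_mono nhdsWithin_le_nhds).and
    (self_mem_nhdsWithin (s := Set.Ioi (0:ℝ)))).exists
  refine ⟨x, hx, lt_of_le_of_lt ?_ hxc⟩
  rw [gfun_eq_sqrt_mul hx, inv_two_rpow_eq_exp]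
  have hu : 0 < x * Real.log 2 := mul_pos hx (Real.log_pos (by norm_num))
  gcongr
  linarith [div_one_sub_exp_neg_le hu]

theorem exists_le_gfun {c : ℝ} (hc : 0 < c) : ∃ x, 0 < x ∧ c ≤ gfun x := by
  have hL : 0 < Real.log 2 := Real.log_pos (by norm_num)
  have hL1 : Real.log 2 < 1 := by linarith [Real.log_two_lt_d9]
  set x := (c + 1) / Real.log 2 with hxdef
  have hxL : x * Real.log 2 = c + 1 := by rw [hxdef]; field_simp
  have hx1 : 1 ≤ x := by rw [hxdef, le_div_iff₀ hL]; linarith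
  have hx : 0 < x := by linarith
  refine ⟨x, hx, ?_⟩
  have h2 : (2:ℝ) ≤ (2:ℝ) ^ x := by
    simpa using Real.rpow_le_rpow_of_exponent_le (x := 2) (by norm_num) hx1
  have hs : 1 ≤ √(x * ((2:ℝ) ^ x - 1)) := Real.one_le_sqrt.2 (by nlinarith)
  rw [gfun_eq_sqrt_mul hx, inv_two_rpow_eq_exp, hxL]
  have hq : c + 1 ≤ (c + 1) / (1 - rexp (-(c + 1))) := by
    have h1 : rexp (-(c + 1)) < 1 := Real.exp_lt_one_iff.2 (by linarith)
    rw [le_div_iff₀ (by linarith)]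
    nlinarith [Real.exp_pos (-(c + 1))]
  nlinarith

/-- existence and uniqueness of x'(R,Θ) (part of Theorem 8). -/
theorem stmt_7 (R α ρr ρd ρs ρ0 T : ℝ)
    (hR : 0 < R) (hα : 1 < α) (hT : 1 < T)
    (hρr : 0 < ρr) (hρd : 0 < ρd) (hρs : 0 < ρs) (hρ0 : 0 < ρ0) :
    ∃! x : ℝ, 0 < x ∧ gfun x = (1 + ρd / ρr) * Real.sqrt (R * ρr / α) := by
  have hc : 0 < (1 + ρd / ρr) * Real.sqrt (R * ρr / α) := by positivity
  obtain ⟨a, ha, hac⟩ := exists_gfun_lt hc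
  obtain ⟨b, hb, hbc⟩ := exists_le_gfun hc
  obtain ⟨x, hx, hxc⟩ := isPreconnected_Ioi.intermediate_value (Set.mem_Ioi.2 ha)
    (Set.mem_Ioi.2 hb) gfun_continuousOn ⟨hac.le, hbc⟩
  exact ⟨x, ⟨hx, hxc⟩, fun y hy => gfun_strictMonoOn.injOn hy.1 hx (hy.2.trans hxc.symm)⟩
end

section
/- Let Θ = (α, ρ_r, ρ_d, ρ_s, ρ_0, T) be a parameter tuple satisfying min(T/4, 1/(3·ρ_0/ρ_r), 3·(ρ_d/ρ_r)/(2·ρ_0/ρ_r)) > 10, with β := ρ_d/ρ_r. Suppose R₁ < R₂ < R_max(Θ) are positive reals such that both ρ_r < (α/(1+β)²)·g(R₁)²/R₁ and ρ_r < (α/(1+β)²)·g(R₂)²/R₂ hold. Then ζ'_csi(R₁,Θ) < ζ'_csi(R₂,Θ). -/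
open Real

lemma two_rpow_sub_one_pos {x : ℝ} (hx : 0 < x) : 0 < (2 : ℝ) ^ x - 1 :=
  sub_pos.2 (Real.one_lt_rpow one_lt_two hx)

lemma gfun_div_sqrt {x : ℝ} (hx : 0 < x) :
    gfun x / √x = ((2 : ℝ) ^ x * x * Real.log 2 - (2 : ℝ) ^ x + 1) / √((2 : ℝ) ^ x - 1) := by
  have h1 : √x ≠ 0 := (Real.sqrt_pos.2 hx).ne'
  have h2 : √((2 : ℝ) ^ x - 1) ≠ 0 := (Real.sqrt_pos.2 (two_rpow_sub_one_pos hx)).ne'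
  rw [gfun, Real.sqrt_div hx.le]
  field_simp

lemma hasDerivAt_two_rpow (x : ℝ) :
    HasDerivAt (fun y : ℝ => (2 : ℝ) ^ y) ((2 : ℝ) ^ x * Real.log 2) x :=
  Real.hasStrictDerivAt_const_rpow two_pos x |>.hasDerivAt

lemma monotoneOn_gfun_div_sqrt : MonotoneOn (fun x => gfun x / √x) (Set.Ioi 0) := by
  have hmono : MonotoneOn (fun x : ℝ => ((2 : ℝ) ^ x * x * Real.log 2 - (2 : ℝ) ^ x + 1) /
      √((2 : ℝ) ^ x - 1)) (Set.Ioi 0) := by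
    have hderiv : ∀ x ∈ Set.Ioi (0 : ℝ), HasDerivAt
        (fun x : ℝ => ((2 : ℝ) ^ x * x * Real.log 2 - (2 : ℝ) ^ x + 1) / √((2 : ℝ) ^ x - 1))
        (((((2 : ℝ) ^ x * Real.log 2 * x + (2 : ℝ) ^ x * 1) * Real.log 2 -
          (2 : ℝ) ^ x * Real.log 2) * √((2 : ℝ) ^ x - 1) -
          ((2 : ℝ) ^ x * x * Real.log 2 - (2 : ℝ) ^ x + 1) *
            ((2 : ℝ) ^ x * Real.log 2 / (2 * √((2 : ℝ) ^ x - 1)))) /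
          √((2 : ℝ) ^ x - 1) ^ 2) x := by
      intro x hx
      have hu := two_rpow_sub_one_pos hx
      have h := hasDerivAt_two_rpow x
      exact (((h.mul (hasDerivAt_id x)).mul_const _ |>.sub h).add_const 1).div
        ((h.sub_const 1).sqrt hu.ne') (Real.sqrt_pos.2 hu).ne'
    refine monotoneOn_of_deriv_nonneg (convex_Ioi 0)
      (fun x hx => (hderiv x hx).continuousAt.continuousWithinAt)
      (fun x hx => (hderiv x (interior_subset hx)).differentiableAt.differentiableWithinAt) ?_
    intro x hx
    have hx0 : 0 < x := interior_subset hx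
    rw [(hderiv x hx0).deriv]
    have hu := two_rpow_sub_one_pos hx0
    have hw := Real.sqrt_pos.2 hu
    have hsq : √((2 : ℝ) ^ x - 1) ^ 2 = (2 : ℝ) ^ x - 1 := Real.sq_sqrt hu.le
    have hL : 0 < Real.log 2 := Real.log_pos one_lt_two
    have hexp : Real.log 2 * x + 1 ≤ (2 : ℝ) ^ x := by
      rw [Real.rpow_def_of_pos two_pos]
      exact Real.add_one_le_exp _
    apply div_nonneg _ (sq_nonneg _)
    set w := √((2 : ℝ) ^ x - 1)
    set e := (2 : ℝ) ^ x
    have hkey : 0 ≤ (Real.log 2 * x + 1) * e - 1 - 2 * (Real.log 2 * x) := by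
      have ht : 0 < Real.log 2 * x := mul_pos hL hx0
      nlinarith
    have heq : ((e * Real.log 2 * x + e * 1) * Real.log 2 - e * Real.log 2) * w -
        (e * x * Real.log 2 - e + 1) * (e * Real.log 2 / (2 * w)) =
        e * Real.log 2 * ((Real.log 2 * x + 1) * e - 1 - 2 * (Real.log 2 * x)) / (2 * w) := by
      have hw' := hw.ne'
      field_simp
      rw [hsq]
      ring
    rw [heq]
    have he : 0 < e := by linarith
    positivity
  intro x hx y hy hxy
  simpa only [gfun_div_sqrt hx, gfun_div_sqrt hy] using hmono hx hy hxy

lemma hasDerivAt_sqrt_two_rpow_sub_one_div {x : ℝ} (hx : 0 < x) :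
    HasDerivAt (fun y : ℝ => √(((2 : ℝ) ^ y - 1) / y)) (gfun x / (2 * x ^ 2)) x := by
  have hu := two_rpow_sub_one_pos hx
  have h := (((hasDerivAt_two_rpow x).sub_const 1).div (hasDerivAt_id x) hx.ne').sqrt
    (div_pos hu hx).ne'
  refine h.congr_deriv ?_
  have h1 : √x ≠ 0 := (Real.sqrt_pos.2 hx).ne'
  have h2 : √((2 : ℝ) ^ x - 1) ≠ 0 := (Real.sqrt_pos.2 hu).ne'
  simp only [gfun, id, Pi.div_apply]
  rw [Real.sqrt_div hx.le, Real.sqrt_div hu.le]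
  field_simp
  ring

lemma antitoneOn_mul_sqrt_add_div {A B x₀ : ℝ}
    (hg : ∀ x, 0 < x → x < x₀ → A * gfun x ≤ B) :
    AntitoneOn (fun x : ℝ => 2 * A * √(((2 : ℝ) ^ x - 1) / x) + B / x) (Set.Ioc 0 x₀) := by
  have hderiv : ∀ x ∈ Set.Ioc (0 : ℝ) x₀, HasDerivAt
      (fun x : ℝ => 2 * A * √(((2 : ℝ) ^ x - 1) / x) + B / x) ((A * gfun x - B) / x ^ 2) x := by
    intro x hx
    have h := ((hasDerivAt_sqrt_two_rpow_sub_one_div hx.1).const_mul (2 * A)).add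
      ((hasDerivAt_inv hx.1.ne').const_mul B)
    refine h.congr_deriv ?_
    have := hx.1.ne'
    field_simp
    ring
  refine antitoneOn_of_deriv_nonpos (convex_Ioc 0 x₀)
    (fun x hx => (hderiv x hx).continuousAt.continuousWithinAt)
    (fun x hx => (hderiv x (interior_subset hx)).differentiableAt.differentiableWithinAt) ?_
  intro x hx
  rw [(hderiv x (interior_subset hx)).deriv]
  rw [interior_Ioc] at hx
  exact div_nonpos_of_nonpos_of_nonneg (sub_nonpos.2 (hg x hx.1 hx.2)) (sq_nonneg x)

lemma two_mul_sqrt_le_Pcsi {M K R α ρr ρd ρs : ℝ} (hα : 0 < α) (hρr : 0 < ρr) (hK : 0 < K)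
    (hR : 0 < R) (hKM : K < M) :
    2 * √(α * K * ((2 : ℝ) ^ (R / K) - 1) * ρr) + K * (ρr + ρd) + ρs ≤
      Pcsi M K R α ρr ρd ρs := by
  have hs := two_rpow_sub_one_pos (div_pos hR hK)
  have hd : 0 < M - K := sub_pos.2 hKM
  have ha : 0 ≤ α * K * ((2 : ℝ) ^ (R / K) - 1) / (M - K) := by positivity
  have hb : 0 ≤ (M - K) * ρr := by positivity
  have heq : α * K * ((2 : ℝ) ^ (R / K) - 1) * ρr =
      α * K * ((2 : ℝ) ^ (R / K) - 1) / (M - K) * ((M - K) * ρr) := by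
    field_simp
  rw [Pcsi, heq, Real.sqrt_mul ha]
  nlinarith [sq_nonneg (√(α * K * ((2 : ℝ) ^ (R / K) - 1) / (M - K)) - √((M - K) * ρr)),
    Real.sq_sqrt ha, Real.sq_sqrt hb]

lemma exists_Pcsi_eq {K R α ρr : ℝ} (ρd ρs : ℝ) (hα : 0 < α) (hρr : 0 < ρr) (hK : 0 < K)
    (hR : 0 < R) :
    ∃ M, K < M ∧ Pcsi M K R α ρr ρd ρs =
      2 * √(α * K * ((2 : ℝ) ^ (R / K) - 1) * ρr) + K * (ρr + ρd) + ρs := by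
  have hs := two_rpow_sub_one_pos (div_pos hR hK)
  have hpos : 0 < α * K * ((2 : ℝ) ^ (R / K) - 1) * ρr := by positivity
  have hw := Real.sqrt_pos.2 hpos
  have hsq := Real.sq_sqrt hpos.le
  refine ⟨K + √(α * K * ((2 : ℝ) ^ (R / K) - 1) * ρr) / ρr,
    lt_add_of_pos_right _ (by positivity), ?_⟩
  rw [Pcsi]
  set w := √(α * K * ((2 : ℝ) ^ (R / K) - 1) * ρr)
  have h : α * K * ((2 : ℝ) ^ (R / K) - 1) / (K + w / ρr - K) = w := by
    rw [add_sub_cancel_left, div_eq_iff (by positivity)]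
    field_simp
    linarith
  rw [h]
  field_simp
  ring

lemma sqrt_power_eq {K R α ρr : ℝ} (hα : 0 < α) (hρr : 0 < ρr) (hK : 0 < K) (hR : 0 < R) :
    √(α * K * ((2 : ℝ) ^ (R / K) - 1) * ρr) =
      R * (√(α * ρr / R) * √(((2 : ℝ) ^ (R / K) - 1) / (R / K))) := by
  have hs := two_rpow_sub_one_pos (div_pos hR hK)
  rw [← Real.sqrt_mul (by positivity), show α * K * ((2 : ℝ) ^ (R / K) - 1) * ρr =
    R ^ 2 * (α * ρr / R * (((2 : ℝ) ^ (R / K) - 1) / (R / K))) by field_simp,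
    Real.sqrt_mul (sq_nonneg R), Real.sqrt_sq hR.le]

lemma mul_gfun_le {α ρr ρd c R Km : ℝ} (hα : 0 < α) (hρr : 0 < ρr) (hρd : 0 < ρd)
    (hKm : 0 < Km) (hR : 0 < R)
    (hgc : gfun c / √c = (1 + ρd / ρr) * √(Km * ρr / α)) (hRc : R < c * Km)
    {x : ℝ} (hx : 0 < x) (hxR : x < R / Km) :
    √(α * ρr / R) * gfun x ≤ ρr + ρd := by
  have hxc : x < c := hxR.trans ((div_lt_iff₀ hKm).2 hRc)
  have hq : gfun x / √x ≤ (1 + ρd / ρr) * √(Km * ρr / α) :=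
    hgc ▸ monotoneOn_gfun_div_sqrt hx (hx.trans hxc) hxc.le
  have hsx : √x ≤ √(R / Km) := Real.sqrt_le_sqrt hxR.le
  have hprod : √(α * ρr / R) * (√(Km * ρr / α) * √(R / Km)) = ρr := by
    rw [← Real.sqrt_mul (by positivity), ← Real.sqrt_mul (by positivity),
      show α * ρr / R * (Km * ρr / α * (R / Km)) = ρr ^ 2 by field_simp, Real.sqrt_sq hρr.le]
  calc √(α * ρr / R) * gfun x ≤ √(α * ρr / R) * ((1 + ρd / ρr) * √(Km * ρr / α) * √x) := by
        gcongr
        exact (div_le_iff₀ (Real.sqrt_pos.2 hx)).1 hq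
    _ ≤ √(α * ρr / R) * ((1 + ρd / ρr) * √(Km * ρr / α) * √(R / Km)) := by gcongr
    _ = (1 + ρd / ρr) * (√(α * ρr / R) * (√(Km * ρr / α) * √(R / Km))) := by ring
    _ = ρr + ρd := by rw [hprod]; field_simp

lemma exists_Pcsi_le {α ρr ρd ρs R₁ R₂ M K Km : ℝ} (hα : 0 < α) (hρr : 0 < ρr)
    (hR₁ : 0 < R₁) (hR₁₂ : R₁ < R₂) (hKm : 1 ≤ Km)
    (hg : ∀ x, 0 < x → x < R₂ / Km → √(α * ρr / R₂) * gfun x ≤ ρr + ρd)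
    (hK : 1 ≤ K) (hKM : K < M) :
    ∃ M' K', 1 ≤ K' ∧ K' ≤ Km ∧ K' < M' ∧
      Pcsi M' K' R₂ α ρr ρd ρs + ρs * (R₂ / R₁ - 1) ≤ R₂ / R₁ * Pcsi M K R₁ α ρr ρd ρs := by
  have hR₂ : 0 < R₂ := hR₁.trans hR₁₂
  have hK0 : 0 < K := one_pos.trans_le hK
  have hKm0 : 0 < Km := one_pos.trans_le hKm
  have hl : 1 < R₂ / R₁ := (one_lt_div hR₁).2 hR₁₂
  have hs := two_rpow_sub_one_pos (div_pos hR₁ hK0)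
  rcases le_or_gt (R₂ / R₁ * K) Km with h | h
  · refine ⟨R₂ / R₁ * M, R₂ / R₁ * K, one_le_mul_of_one_le_of_one_le hl.le hK, h,
      mul_lt_mul_of_pos_left hKM (by positivity), ?_⟩
    have hd : 0 < M - K := sub_pos.2 hKM
    have hx : R₂ / (R₂ / R₁ * K) = R₁ / K := by field_simp
    simp only [Pcsi, hx]
    set s := (2 : ℝ) ^ (R₁ / K) - 1
    have ha : 0 ≤ α * K * s / (M - K) := by positivity
    have heq : α * (R₂ / R₁ * K) * s / (R₂ / R₁ * M - R₂ / R₁ * K) = α * K * s / (M - K) := by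
      rw [← mul_sub]
      field_simp
    rw [heq]
    nlinarith
  · obtain ⟨M', hM', hP⟩ := exists_Pcsi_eq ρd ρs hα hρr hKm0 hR₂
    refine ⟨M', Km, hKm, le_rfl, hM', ?_⟩
    have hlow := two_mul_sqrt_le_Pcsi (ρd := ρd) (ρs := ρs) hα hρr hK0 hR₁ hKM
    have hx : R₁ / K ≤ R₂ / Km := by
      rw [div_le_div_iff₀ hK0 hKm0]
      rw [div_mul_eq_mul_div, lt_div_iff₀ hR₁] at h
      linarith
    have hanti := antitoneOn_mul_sqrt_add_div hg ⟨div_pos hR₁ hK0, hx⟩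
      ⟨div_pos hR₂ hKm0, le_rfl⟩ hx
    simp only [div_div_eq_mul_div] at hanti
    have hA : √(α * ρr / R₂) ≤ √(α * ρr / R₁) := by gcongr
    rw [hP]
    rw [sqrt_power_eq hα hρr hKm0 hR₂]
    rw [sqrt_power_eq hα hρr hK0 hR₁] at hlow
    simp only [div_div_eq_mul_div]
    simp only [div_div_eq_mul_div] at hlow
    set s₁ := √(((2 : ℝ) ^ (R₁ / K) - 1) * K / R₁)
    set s₂ := √(((2 : ℝ) ^ (R₂ / Km) - 1) * Km / R₂)
    have hs₁ : 0 ≤ s₁ := Real.sqrt_nonneg _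
    calc _ = R₂ * (2 * √(α * ρr / R₂) * s₂ + (ρr + ρd) * Km / R₂) + ρs * (R₂ / R₁) := by
          field_simp
          ring
      _ ≤ R₂ * (2 * √(α * ρr / R₂) * s₁ + (ρr + ρd) * K / R₁) + ρs * (R₂ / R₁) := by gcongr
      _ ≤ R₂ * (2 * √(α * ρr / R₁) * s₁ + (ρr + ρd) * K / R₁) + ρs * (R₂ / R₁) := by gcongr
      _ = R₂ / R₁ * (2 * (R₁ * (√(α * ρr / R₁) * s₁)) + K * (ρr + ρd) + ρs) := by
          field_simp
      _ ≤ _ := by gcongr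

lemma le_Pcsi {M K R α ρr ρd ρs : ℝ} (hα : 0 < α) (hρr : 0 < ρr) (hρd : 0 < ρd) (hK : 0 < K)
    (hR : 0 < R) (hKM : K < M) : ρs ≤ Pcsi M K R α ρr ρd ρs := by
  refine le_trans ?_ (two_mul_sqrt_le_Pcsi hα hρr hK hR hKM)
  have := Real.sqrt_nonneg (α * K * ((2 : ℝ) ^ (R / K) - 1) * ρr)
  have : 0 < K * (ρr + ρd) := by positivity
  linarith



/-- ζ'_csi(R,Θ) is strictly increasing in R below R_max(Θ) under (D.3)
(Lemma 6). -/
theorem stmt_11 (α ρr ρd ρs ρ0 T R₁ R₂ c : ℝ)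
    (hα : 1 < α) (hρr : 0 < ρr) (hρd : 0 < ρd) (hρs : 0 < ρs) (hρ0 : 0 < ρ0) (hT : 1 < T)
    (hcond : 10 < min (T / 4) (min (1 / (3 * (ρ0 / ρr))) (3 * (ρd / ρr) / (2 * (ρ0 / ρr)))))
    (hc : 0 < c)
    (hgc : gfun c / Real.sqrt c = (1 + ρd / ρr) * Real.sqrt (Kmax ρr ρd ρ0 T * ρr / α))
    (hR₁ : 0 < R₁) (hR₁₂ : R₁ < R₂) (hR₂max : R₂ < c * Kmax ρr ρd ρ0 T)
    (hD3a : ρr < α / (1 + ρd / ρr) ^ 2 * (gfun R₁) ^ 2 / R₁)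
    (hD3b : ρr < α / (1 + ρd / ρr) ^ 2 * (gfun R₂) ^ 2 / R₂) :
    zetaCsiPrime R₁ α ρr ρd ρs ρ0 T < zetaCsiPrime R₂ α ρr ρd ρs ρ0 T := by
  have hα0 : 0 < α := one_pos.trans hα
  have hR₂ : 0 < R₂ := hR₁.trans hR₁₂
  have hKm : 1 ≤ Kmax ρr ρd ρ0 T := by
    rw [show 1 / (3 * (ρ0 / ρr)) = ρr / (3 * ρ0) by field_simp,
      show 3 * (ρd / ρr) / (2 * (ρ0 / ρr)) = 3 * ρd / (2 * ρ0) by field_simp] at hcond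
    rw [Kmax]
    linarith
  have hlb : ∀ R, 0 < R → ρs ∈ lowerBounds {p : ℝ | ∃ M K : ℝ, 1 ≤ K ∧ K ≤ Kmax ρr ρd ρ0 T ∧
      K < M ∧ p = Pcsi M K R α ρr ρd ρs} := by
    rintro R hR p ⟨M, K, hK, -, hKM, rfl⟩
    exact le_Pcsi hα0 hρr hρd (one_pos.trans_le hK) hR hKM
  have hne : ∀ R, {p : ℝ | ∃ M K : ℝ, 1 ≤ K ∧ K ≤ Kmax ρr ρd ρ0 T ∧
      K < M ∧ p = Pcsi M K R α ρr ρd ρs}.Nonempty :=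
    fun R => ⟨_, 2, 1, le_rfl, hKm, one_lt_two, rfl⟩
  have hg : ∀ x, 0 < x → x < R₂ / Kmax ρr ρd ρ0 T → √(α * ρr / R₂) * gfun x ≤ ρr + ρd :=
    fun x => mul_gfun_le hα0 hρr hρd (one_pos.trans_le hKm) hR₂ hgc hR₂max
  rw [zetaCsiPrime, zetaCsiPrime, div_lt_div_iff₀
    (hρs.trans_le (le_csInf (hne R₁) (hlb R₁ hR₁))) (hρs.trans_le (le_csInf (hne R₂) (hlb R₂ hR₂)))]
  set I₂ := sInf {p : ℝ | ∃ M K : ℝ, 1 ≤ K ∧ K ≤ Kmax ρr ρd ρ0 T ∧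
    K < M ∧ p = Pcsi M K R₂ α ρr ρd ρs}
  have hmain : (I₂ + ρs * (R₂ / R₁ - 1)) / (R₂ / R₁) ≤ sInf {p : ℝ | ∃ M K : ℝ, 1 ≤ K ∧
      K ≤ Kmax ρr ρd ρ0 T ∧ K < M ∧ p = Pcsi M K R₁ α ρr ρd ρs} := by
    refine le_csInf (hne R₁) ?_
    rintro p ⟨M, K, hK, -, hKM, rfl⟩
    obtain ⟨M', K', hK', hK'm, hKM', hle⟩ :=
      exists_Pcsi_le (ρs := ρs) hα0 hρr hR₁ hR₁₂ hKm hg hK hKM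
    have hI : I₂ ≤ Pcsi M' K' R₂ α ρr ρd ρs :=
      csInf_le ⟨ρs, hlb R₂ hR₂⟩ ⟨M', K', hK', hK'm, hKM', rfl⟩
    rw [div_le_iff₀' (by positivity)]
    linarith
  have hgap : 0 < ρs * (R₂ / R₁ - 1) := mul_pos hρs (sub_pos.2 ((one_lt_div hR₁).2 hR₁₂))
  rw [div_le_iff₀' (by positivity), div_mul_eq_mul_div, le_div_iff₀ hR₁] at hmain
  nlinarith
end
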